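/- arXiv:0905.2844 — 5 statements merged into one kernel-verified Lean document; each statement's English description precedes it below -/
import Mathlib

section
/- Let U ⊆ ℂⁿ be open and connected and let F : U → ℂ be twice complex differentiable on U. Suppose that the Euler relation of degree 1 holds for each first partial derivative of F, i.e. Σⱼ zⱼ·(∂²F/∂zⱼ∂zᵢ)(z) = (∂F/∂zᵢ)(z) for all z ∈ U and all i. Define F̃(z) := (1/2)·Σᵢ zᵢ·(∂F/∂zᵢ)(z). Then: (1) F − F̃ is constant on U; (2) F̃ satisfies the Euler relation of degree 2: Σⱼ zⱼ·(∂F̃/∂zⱼ)(z) = 2·F̃(z) for all z ∈ U. -/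
/-- Partial derivative of a function of several complex variables in the
direction of the `i`-th standard basis vector. -/
noncomputable def pd {m : ℕ} (F : (Fin m → ℂ) → ℂ) (i : Fin m) :
    (Fin m → ℂ) → ℂ :=
  fun z => fderiv ℂ F z (Pi.single i 1)

/-- If the first partial derivatives of a twice complex differentiable function
`F` on an open connected set satisfy the Euler relation of degree 1, then
`F̃ := (1/2) Σᵢ zᵢ Fᵢ` differs from `F` by a constant, and `F̃` satisfies the
Euler relation of degree 2. -/
theorem prepotential_homogeneous_of_degree_two (n : ℕ) (U : Set (Fin n → ℂ))
    (hU : IsOpen U) (hconn : IsConnected U)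
    (F : (Fin n → ℂ) → ℂ) (hF : ContDiffOn ℂ 2 F U)
    (heuler : ∀ z ∈ U, ∀ i, ∑ j, z j * pd (pd F i) j z = pd F i z) :
    (∃ c : ℂ, ∀ z ∈ U, F z - (1 / 2) * ∑ i, z i * pd F i z = c) ∧
    (∀ z ∈ U, ∑ j, z j * pd (fun w => (1 / 2) * ∑ i, w i * pd F i w) j z
        = 2 * ((1 / 2) * ∑ i, z i * pd F i z)) := by
  have hat : ∀ z ∈ U, ContDiffAt ℂ 2 F z := fun z hz => hF.contDiffAt (hU.mem_nhds hz)
  have hd2 : ∀ z ∈ U, DifferentiableAt ℂ (fderiv ℂ F) z := fun z hz =>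
    ((hat z hz).fderiv_right (m := 1) (by norm_num)).differentiableAt (by norm_num)
  have hpd : ∀ z ∈ U, ∀ i, DifferentiableAt ℂ (pd F i) z := fun z hz i =>
    (hd2 z hz).clm_apply (differentiableAt_const _)
  have hpp : ∀ z ∈ U, ∀ i j, pd (pd F i) j z
      = fderiv ℂ (fderiv ℂ F) z (Pi.single j 1) (Pi.single i 1) := by
    intro z hz i j
    have h := ((hd2 z hz).hasFDerivAt.clm_apply
      (hasFDerivAt_const (Pi.single i (1 : ℂ) : Fin n → ℂ) z)).fderiv
    change fderiv ℂ (fun w => fderiv ℂ F w (Pi.single i 1)) z (Pi.single j 1) = _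
    rw [h]
    simp
  have hsymm : ∀ z ∈ U, ∀ i j, pd (pd F i) j z = pd (pd F j) i z := by
    intro z hz i j
    rw [hpp z hz, hpp z hz]
    exact ((hat z hz).isSymmSndFDerivAt (by simp)).eq _ _
  have hG : ∀ z ∈ U, HasFDerivAt (fun w : Fin n → ℂ => (1 / 2) * ∑ i, w i * pd F i w)
      ((1 / 2 : ℂ) • ∑ i, (z i • fderiv ℂ (pd F i) z
        + pd F i z • ContinuousLinearMap.proj (R := ℂ) (φ := fun _ : Fin n => ℂ) i)) z := by
    intro z hz
    refine HasFDerivAt.const_mul (HasFDerivAt.fun_sum fun i _ => ?_) _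
    exact (hasFDerivAt_apply i z).mul (hpd z hz i).hasFDerivAt
  have hGj : ∀ z ∈ U, ∀ j,
      pd (fun w : Fin n → ℂ => (1 / 2) * ∑ i, w i * pd F i w) j z = pd F j z := by
    intro z hz j
    have h1 : ∑ i, z i * fderiv ℂ (pd F i) z (Pi.single j 1) = pd F j z := by
      rw [← heuler z hz j]
      exact Finset.sum_congr rfl fun i _ => congrArg _ (hsymm z hz i j)
    have h2 : ∑ i, pd F i z * (Pi.single j (1 : ℂ) : Fin n → ℂ) i = pd F j z := by
      simp [Pi.single_apply]
    change fderiv ℂ (fun w : Fin n → ℂ => (1 / 2) * ∑ i, w i * pd F i w) z (Pi.single j 1) = _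
    rw [(hG z hz).fderiv]
    simp only [ContinuousLinearMap.smul_apply, ContinuousLinearMap.sum_apply,
      ContinuousLinearMap.add_apply, ContinuousLinearMap.proj_apply, smul_eq_mul,
      Finset.sum_add_distrib, h1, h2]
    ring
  have hdF : ∀ z ∈ U, DifferentiableAt ℂ F z := fun z hz =>
    (hat z hz).differentiableAt (by norm_num)
  constructor
  · refine hU.exists_is_const_of_fderiv_eq_zero (𝕜 := ℂ) hconn.isPreconnected
      (f := fun z => F z - (1 / 2) * ∑ i, z i * pd F i z)
      (fun z hz => ((hdF z hz).sub (hG z hz).differentiableAt).differentiableWithinAt) ?_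
    intro z hz
    rw [fderiv_fun_sub (hdF z hz) (hG z hz).differentiableAt]
    change _ = (0 : (Fin n → ℂ) →L[ℂ] ℂ)
    rw [sub_eq_zero]
    apply ContinuousLinearMap.coe_injective
    refine LinearMap.pi_ext' fun j => LinearMap.ext_ring ?_
    exact (hGj z hz j).symm
  · intro z hz
    rw [Finset.sum_congr rfl fun j _ => congrArg (z j * ·) (hGj z hz j)]
    ring
end

section
/- Let 𝓕 : ℂⁿ → ℂ be complex differentiable and define F on {X ∈ ℂ^{n+1} : X₀ ≠ 0} by F(X) = X₀² · 𝓕(X₁/X₀, …, Xₙ/X₀), with F_I := ∂F/∂X_I. Then for every X with X₀ ≠ 0, writing Zⁱ := Xᵢ/X₀, one has −i·Σ_I (X_I · conj(F_I(X)) − F_I(X) · conj(X_I)) = |X₀|² · Y, where Y := i·(2·(𝓕(Z) − conj 𝓕(Z)) − Σᵢ (Zⁱ − conj Zⁱ)·(𝓕ᵢ(Z) + conj 𝓕ᵢ(Z))) and 𝓕ᵢ = ∂𝓕/∂Zⁱ. Consequently −log(−i(X^I conj F_I − F_I conj X^I)) = −log Y − log(X₀ · conj X₀) wherever both sides are defined.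 -/
open ComplexConjugate

theorem aux_fderiv (n : ℕ) (𝓕 : (Fin n → ℂ) → ℂ)
    (h𝓕 : Differentiable ℂ 𝓕) (X : Fin (n + 1) → ℂ) (hX : X 0 ≠ 0) (v : Fin (n + 1) → ℂ) :
    fderiv ℂ (fun W : Fin (n + 1) → ℂ => (W 0) ^ 2 * 𝓕 (fun i => W i.succ / W 0)) X v
      = 2 * X 0 * v 0 * 𝓕 (fun i => X i.succ / X 0)
        + X 0 * fderiv ℂ 𝓕 (fun i => X i.succ / X 0)
          (fun i => v i.succ - X i.succ / X 0 * v 0) := by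
  have hp : ∀ j : Fin (n + 1), HasFDerivAt (fun W : Fin (n + 1) → ℂ => W j)
      (ContinuousLinearMap.proj (R := ℂ) (φ := fun _ : Fin (n + 1) => ℂ) j) X :=
    fun j => hasFDerivAt_apply j X
  have hinv := (hasDerivAt_inv hX).comp_hasFDerivAt X (hp 0)
  have hZ := hasFDerivAt_pi.2 (fun i : Fin n => (hp i.succ).mul hinv)
  have hf := HasFDerivAt.comp (g := 𝓕) X (h𝓕 _).hasFDerivAt hZ
  have h := ((hp 0).pow 2).mul hf
  have h2 := h.fderiv
  have e : (fun W : Fin (n + 1) → ℂ => (W 0) ^ 2 * 𝓕 (fun i => W i.succ / W 0)) =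
    ((fun W : Fin (n + 1) → ℂ => W 0) ^ 2 * (𝓕 ∘ fun (W : Fin (n + 1) → ℂ) (i : Fin n) => W i.succ * (W 0)⁻¹)) := by
    funext W; simp [div_eq_mul_inv]
  have h3 := congrArg (fun L => L v) (h2)
  have e2 : (fun i : Fin n => v i.succ - X i.succ / X 0 * v 0) = X 0 • (fun i : Fin n =>
      X i.succ * (-(X 0 ^ 2)⁻¹ * v 0) + (X 0)⁻¹ * v i.succ) := by
    funext i; simp; field_simp; ring
  rw [e2, map_smul, e]
  refine h3.trans ?_
  simp [ContinuousLinearMap.pi, div_eq_mul_inv]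
  have e3 : (LinearMap.pi fun i : Fin n => -(X i.succ • (X 0 ^ 2)⁻¹ •
        (LinearMap.proj 0 : (Fin (n + 1) → ℂ) →ₗ[ℂ] ℂ))
      + (X 0)⁻¹ • (LinearMap.proj i.succ : (Fin (n + 1) → ℂ) →ₗ[ℂ] ℂ)) v
      = fun i : Fin n => -(X i.succ * ((X 0 ^ 2)⁻¹ * v 0)) + (X 0)⁻¹ * v i.succ := by
    funext i; simp
  rw [e3]
  ring

theorem aux_sum {n : ℕ} (L : (Fin n → ℂ) →L[ℂ] ℂ) (w : Fin n → ℂ) :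
    L w = ∑ i, w i * L (Pi.single i 1) := by
  conv_lhs => rw [pi_eq_sum_univ' w]
  simp [map_sum]

/-- For the homogeneous prepotential `F(X) = X₀² 𝓕(X/X₀)`, one has
`−i Σ_I (X_I F̄_I − F_I X̄_I) = |X₀|² Y` where
`Y = i(2(𝓕 − 𝓕̄) − Σᵢ (Zⁱ − Z̄ⁱ)(𝓕ᵢ + 𝓕̄ᵢ))`.  Consequently
`−log(−i(X^I F̄_I − F_I X̄^I)) = −log Y − log(X₀ X̄₀)` wherever both sides are
defined (i.e. for `Y` a positive real). -/
theorem kahler_potential_rescaling (n : ℕ) (𝓕 : (Fin n → ℂ) → ℂ)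
    (h𝓕 : Differentiable ℂ 𝓕) (X : Fin (n + 1) → ℂ) (hX : X 0 ≠ 0) :
    let F : (Fin (n + 1) → ℂ) → ℂ :=
      fun W => (W 0) ^ 2 * 𝓕 (fun i => W i.succ / W 0)
    let Z : Fin n → ℂ := fun i => X i.succ / X 0
    let Y : ℂ := Complex.I * (2 * (𝓕 Z - conj (𝓕 Z))
      - ∑ i, (Z i - conj (Z i)) * (pd 𝓕 i Z + conj (pd 𝓕 i Z)))
    (-Complex.I * ∑ I, (X I * conj (pd F I X) - pd F I X * conj (X I))
        = (Complex.normSq (X 0) : ℂ) * Y) ∧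
    (Y.im = 0 → 0 < Y.re →
      -Complex.log (-Complex.I
          * ∑ I, (X I * conj (pd F I X) - pd F I X * conj (X I)))
        = -Complex.log Y - Complex.log ((Complex.normSq (X 0) : ℂ))) := by
  intro F Z Y
  have h0 : pd F 0 X = X 0 * (2 * 𝓕 Z - ∑ i, Z i * pd 𝓕 i Z) := by
    unfold pd
    rw [aux_fderiv n 𝓕 h𝓕 X hX, ← aux_sum (fderiv ℂ 𝓕 Z) Z]
    have : (fun i : Fin n => (Pi.single (0 : Fin (n + 1)) (1 : ℂ) : Fin (n + 1) → ℂ) i.succ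
        - X i.succ / X 0 * (Pi.single (0 : Fin (n + 1)) (1 : ℂ) : Fin (n + 1) → ℂ) 0) = - Z := by
      funext i; simp [Z]
    rw [this, map_neg]
    simp only [Pi.single_eq_same]
    ring
  have hs : ∀ i : Fin n, pd F i.succ X = X 0 * pd 𝓕 i Z := by
    intro i
    unfold pd
    rw [aux_fderiv n 𝓕 h𝓕 X hX]
    have : (fun j : Fin n => (Pi.single i.succ (1 : ℂ) : Fin (n + 1) → ℂ) j.succ
        - X j.succ / X 0 * (Pi.single i.succ (1 : ℂ) : Fin (n + 1) → ℂ) 0) = Pi.single i 1 := by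
      funext j
      simp [Pi.single_apply]
    rw [this]
    simp [Z]
  have hXs : ∀ i : Fin n, X i.succ = X 0 * Z i := by
    intro i; simp only [Z]; field_simp
  have key : -Complex.I * ∑ I, (X I * conj (pd F I X) - pd F I X * conj (X I))
        = (Complex.normSq (X 0) : ℂ) * Y := by
    rw [Fin.sum_univ_succ, h0]
    simp only [hs, hXs, ← Complex.mul_conj, Y, map_mul, map_sub, map_sum, map_ofNat]
    have e : ∀ i, X 0 * Z i * (conj (X 0) * conj (pd 𝓕 i Z))
        - X 0 * pd 𝓕 i Z * (conj (X 0) * conj (Z i))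
        = X 0 * conj (X 0) * ((Z i - conj (Z i)) * (pd 𝓕 i Z + conj (pd 𝓕 i Z))
          - Z i * pd 𝓕 i Z + conj (Z i) * conj (pd 𝓕 i Z)) := fun i => by ring
    simp only [e, ← Finset.mul_sum, Finset.sum_add_distrib, Finset.sum_sub_distrib]
    ring
  refine ⟨key, fun him hre => ?_⟩
  rw [key]
  have hY : Y = (Y.re : ℂ) := by
    apply Complex.ext <;> simp [him]
  have hn : 0 < Complex.normSq (X 0) := Complex.normSq_pos.2 hX
  have hY0 : Y ≠ 0 := by
    intro h; rw [h] at hre; simp at hre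
  rw [Complex.log_ofReal_mul hn hY0, Complex.ofReal_log hn.le]
  ring
end

section
/- Let u, w ∈ ℝ⁴ (Euclidean space). Then the following are equivalent: (1) for all μ, ν ∈ {0,1,2,3}, 2·u_μ·u_ν − 2·w_μ·w_ν = δ_{μν}·(‖u‖² − ‖w‖²), where δ_{μν} = 1 if μ = ν and 0 otherwise; (2) u = w or u = −w. -/
/-- For vectors `u, w ∈ ℝ⁴`, the vanishing of the flat-space energy-momentum
tensor `2u_μu_ν − 2w_μw_ν = δ_{μν}(‖u‖² − ‖w‖²)` holds for all `μ, ν`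
if and only if `u = w` or `u = −w`. -/
theorem energy_momentum_vanishing_iff (u w : EuclideanSpace ℝ (Fin 4)) :
    (∀ μ ν : Fin 4, 2 * u μ * u ν - 2 * w μ * w ν
        = (if μ = ν then (1 : ℝ) else 0) * (‖u‖ ^ 2 - ‖w‖ ^ 2))
      ↔ (u = w ∨ u = -w) := by
  constructor
  · intro h
    have hu : ‖u‖ ^ 2 = u 0 ^ 2 + u 1 ^ 2 + u 2 ^ 2 + u 3 ^ 2 := by
      rw [EuclideanSpace.real_norm_sq_eq, Fin.sum_univ_four]
    have hw : ‖w‖ ^ 2 = w 0 ^ 2 + w 1 ^ 2 + w 2 ^ 2 + w 3 ^ 2 := by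
      rw [EuclideanSpace.real_norm_sq_eq, Fin.sum_univ_four]
    have hD : ‖u‖ ^ 2 - ‖w‖ ^ 2 = 0 := by
      have h0 := h 0 0
      have h1 := h 1 1
      have h2 := h 2 2
      have h3 := h 3 3
      simp only [if_true] at h0 h1 h2 h3
      linarith
    have key : ∀ i j, u i * u j = w i * w j := by
      intro i j
      have := h i j
      rw [hD, mul_zero] at this
      linarith
    by_cases huw : u = w
    · exact Or.inl huw
    · right
      have hex : ∃ i, u i ≠ w i := by
        by_contra hc
        push Not at hc
        exact huw (by ext i; exact hc i)
      obtain ⟨i, hi⟩ := hex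
      have hii : u i = - w i := by
        rcases mul_self_eq_mul_self_iff.mp (key i i) with h1 | h1
        · exact absurd h1 hi
        · exact h1
      have hwi : w i ≠ 0 := by
        intro h0
        apply hi
        rw [hii, h0, neg_zero]
      ext j
      have hj := key i j
      rw [hii] at hj
      have : w i * (u j) = w i * (-w j) := by linarith
      simpa using mul_left_cancel₀ hwi this
  · rintro (rfl | rfl) <;> intro μ ν <;> simp
end

section
/- Let U ⊆ ℝ⁴ be open and let φ, a : U → ℝ be twice continuously differentiable, satisfying the instanton ansatz ∂_μ φ = (1/2)·exp(2φ)·∂_μ a on U for all μ ∈ {0,1,2,3}. Then for every x ∈ U: (1) Δφ(x) = −(1/2)·exp(4φ(x))·Σ_μ (∂_μ a(x))² holds if and only if Δ(exp∘(2φ))(x) = 0; (2) Δa(x) = −4·Σ_μ ∂_μφ(x)·∂_μ a(x) holds if and only if Δ(exp∘(2φ))(x) = 0. Here Δf(x) := Σ_{μ=0}^{3} ∂_μ∂_μ f(x) is the Euclidean Laplacian. -/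
/-- The `μ`-th standard basis vector of Euclidean ℝ⁴. -/
noncomputable def e4 (μ : Fin 4) : EuclideanSpace ℝ (Fin 4) :=
  EuclideanSpace.single μ 1

/-- The Euclidean Laplacian `Δf = Σ_μ ∂_μ∂_μ f` on ℝ⁴. -/
noncomputable def lap (f : EuclideanSpace ℝ (Fin 4) → ℝ)
    (x : EuclideanSpace ℝ (Fin 4)) : ℝ :=
  ∑ μ, fderiv ℝ (fun y => fderiv ℝ f y (e4 μ)) x (e4 μ)

/-- Under the instanton ansatz `∂_μφ = (1/2)e^{2φ}∂_μ a`, each of the two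
equations of motion `Δφ = −(1/2)e^{4φ}Σ(∂a)²` and `Δa = −4Σ ∂φ∂a` holds at a
point of `U` if and only if `Δ(e^{2φ}) = 0` there. -/
theorem equations_of_motion_iff_harmonic (U : Set (EuclideanSpace ℝ (Fin 4)))
    (hU : IsOpen U) (φ a : EuclideanSpace ℝ (Fin 4) → ℝ)
    (hφ : ContDiffOn ℝ 2 φ U) (ha : ContDiffOn ℝ 2 a U)
    (hansatz : ∀ x ∈ U, ∀ μ : Fin 4,
      fderiv ℝ φ x (e4 μ) = 1 / 2 * Real.exp (2 * φ x) * fderiv ℝ a x (e4 μ))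
    (x : EuclideanSpace ℝ (Fin 4)) (hx : x ∈ U) :
    ((lap φ x = -(1 / 2) * Real.exp (4 * φ x) * ∑ μ, (fderiv ℝ a x (e4 μ)) ^ 2)
        ↔ lap (fun y => Real.exp (2 * φ y)) x = 0) ∧
    ((lap a x = -4 * ∑ μ, fderiv ℝ φ x (e4 μ) * fderiv ℝ a x (e4 μ))
        ↔ lap (fun y => Real.exp (2 * φ y)) x = 0) := by
  have hev : ∀ᶠ y in nhds x, y ∈ U := hU.mem_nhds hx
  have hdφ : ∀ y ∈ U, DifferentiableAt ℝ φ y := fun y hy =>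
    (hφ.contDiffAt (hU.mem_nhds hy)).differentiableAt (by norm_num)
  have hE : ∀ y ∈ U, HasFDerivAt (fun y => Real.exp (2 * φ y))
      (Real.exp (2 * φ y) • ((2 : ℝ) • fderiv ℝ φ y)) y := fun y hy =>
    ((hdφ y hy).hasFDerivAt.const_mul 2).exp
  have hDD : ∀ f : EuclideanSpace ℝ (Fin 4) → ℝ, ContDiffOn ℝ 2 f U → ∀ μ,
      DifferentiableAt ℝ (fun y => fderiv ℝ f y (e4 μ)) x := by
    intro f hf μ
    have h1 : ContDiffAt ℝ 1 (fderiv ℝ f) x :=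
      (hf.contDiffAt (hU.mem_nhds hx)).fderiv_right (by norm_num)
    exact (h1.differentiableAt (by norm_num)).clm_apply (differentiableAt_const _)
  have key1 : ∀ μ, fderiv ℝ (fun y => fderiv ℝ (fun y => Real.exp (2 * φ y)) y (e4 μ)) x (e4 μ)
      = Real.exp (2 * φ x) * (2 * fderiv ℝ (fun y => fderiv ℝ φ y (e4 μ)) x (e4 μ)
        + 4 * (fderiv ℝ φ x (e4 μ)) ^ 2) := by
    intro μ
    have h : (fun y => fderiv ℝ (fun y => Real.exp (2 * φ y)) y (e4 μ)) =ᶠ[nhds x]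
        fun y => Real.exp (2 * φ y) * (2 * fderiv ℝ φ y (e4 μ)) := by
      filter_upwards [hev] with y hy
      rw [(hE y hy).fderiv]
      simp
    rw [h.fderiv_eq, ((hE x hx).fun_mul ((hDD φ hφ μ).hasFDerivAt.const_mul 2)).fderiv]
    simp
    ring
  have key2 : ∀ μ, fderiv ℝ (fun y => fderiv ℝ φ y (e4 μ)) x (e4 μ)
      = Real.exp (2 * φ x) * (fderiv ℝ φ x (e4 μ) * fderiv ℝ a x (e4 μ)
        + 1 / 2 * fderiv ℝ (fun y => fderiv ℝ a y (e4 μ)) x (e4 μ)) := by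
    intro μ
    have h : (fun y => fderiv ℝ φ y (e4 μ)) =ᶠ[nhds x]
        fun y => 1 / 2 * Real.exp (2 * φ y) * fderiv ℝ a y (e4 μ) := by
      filter_upwards [hev] with y hy
      exact hansatz y hy μ
    rw [h.fderiv_eq, (((hE x hx).const_mul (1 / 2)).fun_mul (hDD a ha μ).hasFDerivAt).fderiv]
    simp
    ring
  have h4 : Real.exp (4 * φ x) = Real.exp (2 * φ x) ^ 2 := by
    rw [← Real.exp_nat_mul]; congr 1; push_cast; ring
  have hpos := Real.exp_pos (2 * φ x)
  have L1 : lap (fun y => Real.exp (2 * φ y)) x = 2 * Real.exp (2 * φ x) *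
      (lap φ x - -(1 / 2) * Real.exp (4 * φ x) * ∑ μ, (fderiv ℝ a x (e4 μ)) ^ 2) := by
    simp only [lap, key1, hansatz x hx, h4, Fin.sum_univ_four]
    ring
  have L2 : lap (fun y => Real.exp (2 * φ y)) x = Real.exp (2 * φ x) ^ 2 *
      (lap a x - -4 * ∑ μ, fderiv ℝ φ x (e4 μ) * fderiv ℝ a x (e4 μ)) := by
    simp only [lap, key1, key2, hansatz x hx, Fin.sum_univ_four]
    ring
  constructor
  · rw [L1, mul_eq_zero_iff_left (by positivity), sub_eq_zero]
  · rw [L2, mul_eq_zero_iff_left (by positivity), sub_eq_zero]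
end

section
/- Let ε : (Fin 4)⁴ → ℝ be the Levi-Civita symbol: ε(σ(0),σ(1),σ(2),σ(3)) = sign(σ) for every permutation σ of Fin 4, and ε(α,β,γ,δ) = 0 whenever the indices are not pairwise distinct. Let U ⊆ ℝ⁴ be open, φ : U → ℝ twice continuously differentiable, and A ∈ ℝ. Then for every x ∈ U: Σ_{σ,μ,ν,ρ} ε(σ,μ,ν,ρ)·∂_σ( A·exp(2φ)·Σ_{α} ε(α,μ,ν,ρ)·∂_αφ )(x) = 3·A·Δ(exp∘(2φ))(x), where Δf := Σ_{μ=0}^{3} ∂_μ∂_μ f. In particular, the Bianchi identity ε^{σμνρ}∂_σ H_{μνρ} = 0 for the instanton ansatz H_{μνρ} = A·e^{2φ}·ε^{α}{}_{μνρ}∂_αφ holds at x if and only if Δ(e^{2φ})(x) = 0. -/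
/-- Integer-valued Levi-Civita symbol via the Vandermonde product. -/
def lcInt (a b c d : Fin 4) : ℤ :=
  (((b : ℕ) : ℤ) - (a : ℕ)) * ((c : ℕ) - (a : ℕ)) * ((d : ℕ) - (a : ℕ)) * ((c : ℕ) - (b : ℕ))
    * ((d : ℕ) - (b : ℕ)) * ((d : ℕ) - (c : ℕ)) / 12

set_option maxRecDepth 100000 in
lemma lcInt_perm : ∀ σ : Equiv.Perm (Fin 4),
    lcInt (σ 0) (σ 1) (σ 2) (σ 3) = (Equiv.Perm.sign σ : ℤ) := by
  decide

set_option maxRecDepth 100000 in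
lemma lcInt_zero : ∀ a b c d : Fin 4,
    (a = b ∨ a = c ∨ a = d ∨ b = c ∨ b = d ∨ c = d) → lcInt a b c d = 0 := by
  decide

set_option maxRecDepth 100000 in
lemma lcInt_contract : ∀ s a : Fin 4,
    ∑ m, ∑ n, ∑ r, lcInt s m n r * lcInt a m n r = if s = a then 6 else 0 := by
  decide

lemma eps_eq (ε : Fin 4 → Fin 4 → Fin 4 → Fin 4 → ℝ)
    (hperm : ∀ σ : Equiv.Perm (Fin 4),
      ε (σ 0) (σ 1) (σ 2) (σ 3) = ((Equiv.Perm.sign σ : ℤ) : ℝ))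
    (hzero : ∀ α β γ δ : Fin 4,
      (α = β ∨ α = γ ∨ α = δ ∨ β = γ ∨ β = δ ∨ γ = δ) → ε α β γ δ = 0)
    (a b c d : Fin 4) : ε a b c d = (lcInt a b c d : ℝ) := by
  by_cases h : a = b ∨ a = c ∨ a = d ∨ b = c ∨ b = d ∨ c = d
  · rw [hzero _ _ _ _ h, lcInt_zero _ _ _ _ h]; simp
  · have hinj : Function.Injective ![a, b, c, d] := by
      push Not at h
      obtain ⟨h1, h2, h3, h4, h5, h6⟩ := h
      intro i j hij
      fin_cases i <;> fin_cases j <;> simp_all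
    have hp := hperm (Equiv.ofBijective _ (Finite.injective_iff_bijective.mp hinj))
    rw [← lcInt_perm] at hp
    simpa using hp

lemma eps_contract (ε : Fin 4 → Fin 4 → Fin 4 → Fin 4 → ℝ)
    (hε : ∀ a b c d, ε a b c d = (lcInt a b c d : ℝ)) (A : ℝ) (D : Fin 4 → Fin 4 → ℝ) :
    ∑ s, ∑ m, ∑ n, ∑ r, ε s m n r * (A * ∑ a, ε a m n r * D a s) = 6 * A * ∑ s, D s s := by
  have hc : ∀ s a : Fin 4, ∑ m, ∑ n, ∑ r, ε s m n r * ε a m n r = if s = a then 6 else 0 := by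
    intro s a
    simp only [hε]
    exact_mod_cast lcInt_contract s a
  rw [Finset.mul_sum]
  refine Finset.sum_congr rfl fun s _ => ?_
  have h1 : ∑ m, ∑ n, ∑ r, ε s m n r * (A * ∑ a, ε a m n r * D a s)
      = ∑ a, A * D a s * ∑ m, ∑ n, ∑ r, ε s m n r * ε a m n r := by
    simp only [Finset.mul_sum]
    symm
    rw [Finset.sum_comm]
    refine Finset.sum_congr rfl fun m _ => ?_
    rw [Finset.sum_comm]
    refine Finset.sum_congr rfl fun n _ => ?_
    rw [Finset.sum_comm]
    refine Finset.sum_congr rfl fun r _ => ?_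
    refine Finset.sum_congr rfl fun a _ => ?_
    ring
  rw [h1]
  simp only [hc]
  simp
  ring

/-- For the instanton ansatz `H_{μνρ} = A e^{2φ} ε^α{}_{μνρ}∂_αφ`,
`ε^{σμνρ}∂_σ H_{μνρ} = 3 A Δ(e^{2φ})`; in particular (for `A ≠ 0`) the Bianchi
identity holds at `x` if and only if `Δ(e^{2φ})(x) = 0`. -/
theorem bianchi_identity_iff_harmonic
    (ε : Fin 4 → Fin 4 → Fin 4 → Fin 4 → ℝ)
    (hperm : ∀ σ : Equiv.Perm (Fin 4),
      ε (σ 0) (σ 1) (σ 2) (σ 3) = ((Equiv.Perm.sign σ : ℤ) : ℝ))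
    (hzero : ∀ α β γ δ : Fin 4,
      (α = β ∨ α = γ ∨ α = δ ∨ β = γ ∨ β = δ ∨ γ = δ) → ε α β γ δ = 0)
    (U : Set (EuclideanSpace ℝ (Fin 4))) (hU : IsOpen U)
    (φ : EuclideanSpace ℝ (Fin 4) → ℝ) (hφ : ContDiffOn ℝ 2 φ U) (A : ℝ)
    (x : EuclideanSpace ℝ (Fin 4)) (hx : x ∈ U) :
    (∑ σ, ∑ μ, ∑ ν, ∑ ρ, ε σ μ ν ρ
          * fderiv ℝ (fun y => A * Real.exp (2 * φ y)
            * ∑ α, ε α μ ν ρ * fderiv ℝ φ y (e4 α)) x (e4 σ)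
        = 3 * A * lap (fun y => Real.exp (2 * φ y)) x) ∧
    (A ≠ 0 →
      ((∑ σ, ∑ μ, ∑ ν, ∑ ρ, ε σ μ ν ρ
            * fderiv ℝ (fun y => A * Real.exp (2 * φ y)
              * ∑ α, ε α μ ν ρ * fderiv ℝ φ y (e4 α)) x (e4 σ) = 0)
        ↔ lap (fun y => Real.exp (2 * φ y)) x = 0)) := by
  have hε := eps_eq ε hperm hzero
  have hφx : ∀ y ∈ U, DifferentiableAt ℝ φ y := fun y hy =>
    (hφ.contDiffAt (hU.mem_nhds hy)).differentiableAt (by norm_num)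
  have hdφ : DifferentiableAt ℝ (fderiv ℝ φ) x :=
    ((hφ.contDiffAt (hU.mem_nhds hx)).fderiv_right (m := 1) (by norm_num)).differentiableAt
      (by norm_num)
  have hg : ∀ a, DifferentiableAt ℝ
      (fun y => Real.exp (2 * φ y) * fderiv ℝ φ y (e4 a)) x := by
    intro a
    have h0 := hφx x hx
    exact (h0.const_mul 2).exp.mul (hdφ.clm_apply (differentiableAt_const _))
  have hH : ∀ s m n r : Fin 4, fderiv ℝ (fun y => A * Real.exp (2 * φ y)
            * ∑ α, ε α m n r * fderiv ℝ φ y (e4 α)) x (e4 s)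
      = A * ∑ a, ε a m n r *
        fderiv ℝ (fun y => Real.exp (2 * φ y) * fderiv ℝ φ y (e4 a)) x (e4 s) := by
    intro s m n r
    have h1 : (fun y => A * Real.exp (2 * φ y) * ∑ α, ε α m n r * fderiv ℝ φ y (e4 α))
        = fun y => A * ∑ a, ε a m n r * (Real.exp (2 * φ y) * fderiv ℝ φ y (e4 a)) := by
      funext y
      rw [mul_assoc, Finset.mul_sum]
      congr 1
      refine Finset.sum_congr rfl fun a _ => ?_
      ring
    have h2 : HasFDerivAt
        (fun y => A * ∑ a, ε a m n r * (Real.exp (2 * φ y) * fderiv ℝ φ y (e4 a)))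
        (A • ∑ a, ε a m n r •
          fderiv ℝ (fun y => Real.exp (2 * φ y) * fderiv ℝ φ y (e4 a)) x) x :=
      (HasFDerivAt.fun_sum fun a _ => (hg a).hasFDerivAt.const_mul (ε a m n r)).const_mul A
    rw [h1, h2.fderiv]
    simp
  have hlap : lap (fun y => Real.exp (2 * φ y)) x
      = 2 * ∑ s, fderiv ℝ (fun y => Real.exp (2 * φ y) * fderiv ℝ φ y (e4 s)) x (e4 s) := by
    unfold lap
    rw [Finset.mul_sum]
    refine Finset.sum_congr rfl fun s _ => ?_
    have h1 : (fun y => fderiv ℝ (fun y => Real.exp (2 * φ y)) y (e4 s)) =ᶠ[nhds x]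
        fun y => 2 * (Real.exp (2 * φ y) * fderiv ℝ φ y (e4 s)) := by
      filter_upwards [hU.mem_nhds hx] with y hy
      have h2 := ((hφx y hy).hasFDerivAt.const_mul 2).exp
      rw [h2.fderiv]
      simp
      ring
    rw [h1.fderiv_eq, ((hg s).hasFDerivAt.const_mul 2).fderiv]
    simp
  have hmain : ∑ σ, ∑ μ, ∑ ν, ∑ ρ, ε σ μ ν ρ
          * fderiv ℝ (fun y => A * Real.exp (2 * φ y)
            * ∑ α, ε α μ ν ρ * fderiv ℝ φ y (e4 α)) x (e4 σ)
        = 3 * A * lap (fun y => Real.exp (2 * φ y)) x := by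
    simp only [hH]
    rw [eps_contract ε hε A
      (fun a s => fderiv ℝ (fun y => Real.exp (2 * φ y) * fderiv ℝ φ y (e4 a)) x (e4 s)), hlap]
    ring
  refine ⟨hmain, fun hA => ?_⟩
  rw [hmain]
  simp [hA]
end
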